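/- For every integer n ≥ 3 and every integer r ≥ 0 such that ε_Δ(OP_n) + 3r ≤ n − 3, there exists a maximal outerplanar graph G_r of order n with ε_Δ(G_r) = ε_Δ(OP_n) + 3r. -/

import Mathlib

/-- A triangle on three distinct vertices, as a multiset of edges. -/
def IsTriangle {V : Type*} (t : Multiset (Sym2 V)) : Prop :=
  ∃ a b c : V, a ≠ b ∧ b ≠ c ∧ a ≠ c ∧ t = {s(a, b), s(b, c), s(a, c)}

/-- A multigraph (multiset of edges) is triangle decomposable if it is a sum of triangles. -/
def TriDecomp {V : Type*} (E : Multiset (Sym2 V)) : Prop :=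
  ∃ T : Multiset (Multiset (Sym2 V)), (∀ t ∈ T, IsTriangle t) ∧ T.sum = E

/-- The edge multiset of a simple graph on a finite vertex type. -/
noncomputable def edgeMS {V : Type*} [Fintype V] (G : SimpleGraph V) : Multiset (Sym2 V) :=
  G.edgeSet.toFinite.toFinset.val

/-- `ε_Δ(G)`: the least number of duplicated edges of `G` (a multiset of edges of `G`,
repetitions allowed) whose addition makes the edge multiset triangle decomposable. -/
noncomputable def epsDelta {V : Type*} [Fintype V] (G : SimpleGraph V) : ℕ :=
  sInf {k | ∃ D : Multiset (Sym2 V), D.card = k ∧ (∀ e ∈ D, e ∈ G.edgeSet) ∧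
    TriDecomp (edgeMS G + D)}

/-- The edge set of the simple-clique 2-tree construction on `Fin n`: start with the
triangle on `0,1,2`, and each vertex `k ≥ 3` is attached to the two vertices `a k, b k`. -/
def mopEdges (n : ℕ) (hn : 3 ≤ n) (a b : Fin n → Fin n) : Set (Sym2 (Fin n)) :=
  {e | e = s(⟨0, by omega⟩, ⟨1, by omega⟩) ∨ e = s(⟨1, by omega⟩, ⟨2, by omega⟩) ∨
       e = s(⟨0, by omega⟩, ⟨2, by omega⟩) ∨
       ∃ k : Fin n, 3 ≤ (k : ℕ) ∧ (e = s(k, a k) ∨ e = s(k, b k))}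

/-- `G` is a maximal outerplanar graph (equivalently, a simple-clique 2-tree):
it is built from a triangle by repeatedly adding a new vertex adjacent to exactly the two
endpoints of an existing edge, each edge being used as an attachment edge at most once. -/
def IsMOP {n : ℕ} (G : SimpleGraph (Fin n)) : Prop :=
  ∃ (hn : 3 ≤ n) (a b : Fin n → Fin n),
    (∀ k : Fin n, 3 ≤ (k : ℕ) → (a k : ℕ) < k ∧ (b k : ℕ) < k ∧ a k ≠ b k) ∧
    (∀ k : Fin n, 3 ≤ (k : ℕ) → s(a k, b k) ∈ mopEdges n hn a b) ∧
    (∀ k l : Fin n, 3 ≤ (k : ℕ) → 3 ≤ (l : ℕ) → k ≠ l → s(a k, b k) ≠ s(a l, b l)) ∧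
    G = SimpleGraph.fromEdgeSet (mopEdges n hn a b)

/-- `ε_Δ(OP_n) = min { ε_Δ(G) : G a maximal outerplanar graph of order n }`. -/
noncomputable def epsOP (n : ℕ) : ℕ :=
  sInf {m | ∃ G : SimpleGraph (Fin n), IsMOP G ∧ epsDelta G = m}

section TriangleDecompositions

variable {V : Type*}

lemma IsTriangle.card_eq {t : Multiset (Sym2 V)} (ht : IsTriangle t) : t.card = 3 := by
  obtain ⟨a, b, c, -, -, -, rfl⟩ := ht
  simp

lemma IsTriangle.exists_lt [LinearOrder V] {t : Multiset (Sym2 V)} (ht : IsTriangle t) :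
    ∃ a b c : V, a < b ∧ b < c ∧ t = {s(a, b), s(b, c), s(a, c)} := by
  obtain ⟨a, b, c, hab, hbc, hac, rfl⟩ := ht
  have hsum : ∀ x y z : Sym2 V, ({x, y, z} : Multiset (Sym2 V)) = {x} + {y} + {z} :=
    fun x y z => by rw [add_assoc]; rfl
  simp only [hsum]
  wlog h₁ : a < b generalizing a b
  · obtain ⟨x, y, z, hxy, hyz, h⟩ := this b a hab.symm hac hbc
      (lt_of_le_of_ne (not_lt.1 h₁) hab.symm)
    refine ⟨x, y, z, hxy, hyz, h ▸ ?_⟩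
    rw [Sym2.eq_swap (a := a) (b := b)]
    abel
  rcases lt_or_gt_of_ne hbc with h₂ | h₂
  · exact ⟨a, b, c, h₁, h₂, rfl⟩
  rcases lt_or_gt_of_ne hac with h₃ | h₃
  · refine ⟨a, c, b, h₃, h₂, ?_⟩
    rw [Sym2.eq_swap (a := c) (b := b)]
    abel
  · refine ⟨c, a, b, h₃, h₁, ?_⟩
    rw [Sym2.eq_swap (a := c) (b := b), Sym2.eq_swap (a := c) (b := a)]
    abel

lemma card_sum_of_isTriangle {T : Multiset (Multiset (Sym2 V))} (hT : ∀ t ∈ T, IsTriangle t) :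
    T.sum.card = 3 * T.card := by
  induction T using Multiset.induction with
  | empty => simp
  | cons t T ih =>
    rw [Multiset.sum_cons, Multiset.card_add, Multiset.card_cons,
      ih fun s hs => hT s (Multiset.mem_cons_of_mem hs),
      (hT t (Multiset.mem_cons_self t T)).card_eq]
    ring

lemma countP_sum_le_card (p : Sym2 V → Prop) [DecidablePred p]
    {T : Multiset (Multiset (Sym2 V))} (hT : ∀ t ∈ T, t.countP p ≤ 1) :
    T.sum.countP p ≤ T.card := by
  induction T using Multiset.induction with
  | empty => simp
  | cons t T ih =>
    rw [Multiset.sum_cons, Multiset.countP_add, Multiset.card_cons]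
    have := ih fun s hs => hT s (Multiset.mem_cons_of_mem hs)
    have := hT t (Multiset.mem_cons_self t T)
    omega

variable [Fintype V] {G : SimpleGraph V}

lemma mem_edgeMS {e : Sym2 V} : e ∈ edgeMS G ↔ e ∈ G.edgeSet := by
  simp [edgeMS]

lemma nodup_edgeMS : (edgeMS G).Nodup := Finset.nodup _

/-- A family of triangles of `G` covering all edges yields a set of duplicated edges. -/
lemma exists_duplication {F : Multiset (Multiset (Sym2 V))} (hF : ∀ t ∈ F, IsTriangle t)
    (hFG : ∀ t ∈ F, ∀ e ∈ t, e ∈ G.edgeSet) (hcov : ∀ e ∈ G.edgeSet, ∃ t ∈ F, e ∈ t) :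
    ∃ D : Multiset (Sym2 V), D.card = 3 * F.card - (edgeMS G).card ∧
      (∀ e ∈ D, e ∈ G.edgeSet) ∧ TriDecomp (edgeMS G + D) := by
  classical
  have hle : edgeMS G ≤ F.sum := (Multiset.le_iff_subset nodup_edgeMS).2 fun e he => by
    obtain ⟨t, ht, het⟩ := hcov e (mem_edgeMS.1 he)
    exact Multiset.mem_of_le (Multiset.le_sum_of_mem ht) het
  refine ⟨F.sum - edgeMS G, ?_, fun e he => ?_, F, hF, (add_tsub_cancel_of_le hle).symm⟩
  · rw [Multiset.card_sub hle, card_sum_of_isTriangle hF]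
  · obtain ⟨t, ht, het⟩ := Multiset.mem_join.1 (Multiset.mem_of_le (Multiset.sub_le_self _ _) he)
    exact hFG t ht e het

/-- A set of edges of `G`, no two in a common triangle of `G`, bounds the number of triangles
in a decomposition from below. -/
lemma le_card_duplication (B : Finset (Sym2 V)) (hBG : ∀ e ∈ B, e ∈ G.edgeSet)
    [DecidablePred (· ∈ B)]
    (hB : ∀ t, IsTriangle t → (∀ e ∈ t, e ∈ G.edgeSet) → t.countP (· ∈ B) ≤ 1)
    {D : Multiset (Sym2 V)} (hD : ∀ e ∈ D, e ∈ G.edgeSet) (hGD : TriDecomp (edgeMS G + D)) :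
    3 * B.card ≤ (edgeMS G).card + D.card := by
  obtain ⟨T, hT, hTs⟩ := hGD
  have hBle : B.val ≤ T.sum.filter (· ∈ B) := (Multiset.le_iff_subset B.nodup).2 fun e he => by
    rw [Multiset.mem_filter, hTs]
    exact ⟨Multiset.mem_add.2 (Or.inl (mem_edgeMS.2 (hBG e he))), he⟩
  have h1 := Multiset.card_le_card hBle
  rw [← Multiset.countP_eq_card_filter] at h1
  have h2 := countP_sum_le_card (· ∈ B) (T := T) fun t ht => hB t (hT t ht) fun e he => by
    have : e ∈ edgeMS G + D := hTs ▸ Multiset.mem_of_le (Multiset.le_sum_of_mem ht) he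
    rcases Multiset.mem_add.1 this with h | h
    exacts [mem_edgeMS.1 h, hD e h]
  have h3 := card_sum_of_isTriangle hT
  rw [hTs, Multiset.card_add] at h3
  rw [Finset.card_val] at h1
  omega

end TriangleDecompositions

section Parents

variable {n : ℕ}

/-- `a k` and `b k` are the two neighbours preceding each vertex `k ≥ 2` in a construction of
`G` from the edge `01` by successively attaching vertices to edges. -/
structure IsParents (G : SimpleGraph (Fin n)) (a b : Fin n → Fin n) : Prop where
  left_lt : ∀ k : Fin n, 2 ≤ (k : ℕ) → (a k : ℕ) < k
  right_lt : ∀ k : Fin n, 2 ≤ (k : ℕ) → (b k : ℕ) < k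
  ne : ∀ k : Fin n, 2 ≤ (k : ℕ) → (a k : ℕ) ≠ b k
  adj_parents : ∀ k : Fin n, 2 ≤ (k : ℕ) → G.Adj (a k) (b k)
  adj_iff : ∀ x y : Fin n, x < y →
    (G.Adj x y ↔ ((x : ℕ) = 0 ∧ (y : ℕ) = 1) ∨ 2 ≤ (y : ℕ) ∧ (x = a y ∨ x = b y))

lemma mem_mopEdges_iff_of_lt (hn : 3 ≤ n) {a b : Fin n → Fin n}
    (h : ∀ k : Fin n, 3 ≤ (k : ℕ) → (a k : ℕ) < k ∧ (b k : ℕ) < k ∧ a k ≠ b k)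
    {x y : Fin n} (hxy : x < y) :
    s(x, y) ∈ mopEdges n hn a b ↔ (x : ℕ) < 2 ∧ (y : ℕ) ≤ 2 ∨
      3 ≤ (y : ℕ) ∧ (x = a y ∨ x = b y) := by
  rw [Fin.lt_def] at hxy
  simp only [mopEdges, Set.mem_ofPred_eq, Sym2.eq_iff, Fin.ext_iff]
  constructor
  · rintro (h | h | h | ⟨k, hk, h' | h'⟩)
    · omega
    · omega
    · omega
    · have := h k hk
      rcases h' with ⟨h1, h2⟩ | ⟨h1, h2⟩
      · omega
      · obtain rfl : y = k := Fin.ext h2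
        exact Or.inr ⟨hk, Or.inl h1⟩
    · have := h k hk
      rcases h' with ⟨h1, h2⟩ | ⟨h1, h2⟩
      · omega
      · obtain rfl : y = k := Fin.ext h2
        exact Or.inr ⟨hk, Or.inr h1⟩
  · rintro (h | ⟨hy, h | h⟩)
    · omega
    · exact Or.inr (Or.inr (Or.inr ⟨y, hy, Or.inl (Or.inr ⟨h, rfl⟩)⟩))
    · exact Or.inr (Or.inr (Or.inr ⟨y, hy, Or.inr (Or.inr ⟨h, rfl⟩)⟩))

lemma isParents_fromEdgeSet (hn : 3 ≤ n) {a b : Fin n → Fin n}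
    (h : ∀ k : Fin n, 3 ≤ (k : ℕ) → (a k : ℕ) < k ∧ (b k : ℕ) < k ∧ a k ≠ b k)
    (h' : ∀ k : Fin n, 3 ≤ (k : ℕ) → s(a k, b k) ∈ mopEdges n hn a b)
    (ha : ∀ k : Fin n, (k : ℕ) = 2 → (a k : ℕ) = 1)
    (hb : ∀ k : Fin n, (k : ℕ) = 2 → (b k : ℕ) = 0) :
    IsParents (SimpleGraph.fromEdgeSet (mopEdges n hn a b)) a b where
  left_lt k hk := by
    have := h k; have := ha k; omega
  right_lt k hk := by
    have := h k; have := hb k; omega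
  ne k hk := by
    have := h k; have := ha k; have := hb k; omega
  adj_parents k hk := by
    rw [SimpleGraph.fromEdgeSet_adj]
    rcases hk.eq_or_lt with hk | hk
    · have hak := ha k hk.symm
      have hbk := hb k hk.symm
      have hlt : b k < a k := by rw [Fin.lt_def]; omega
      refine ⟨?_, hlt.ne'⟩
      rw [Sym2.eq_swap, mem_mopEdges_iff_of_lt hn h hlt]
      omega
    · exact ⟨h' k hk, (h k hk).2.2⟩
  adj_iff x y hxy := by
    rw [SimpleGraph.fromEdgeSet_adj, mem_mopEdges_iff_of_lt hn h hxy, and_iff_left hxy.ne]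
    have := ha y
    have := hb y
    rw [Fin.lt_def] at hxy
    simp only [Fin.ext_iff]
    omega

lemma IsMOP.exists_isParents {G : SimpleGraph (Fin n)} (hG : IsMOP G) :
    ∃ a b : Fin n → Fin n, IsParents G a b := by
  obtain ⟨hn, a, b, h, h', -, rfl⟩ := hG
  let a' : Fin n → Fin n := fun k => if (k : ℕ) = 2 then ⟨1, by omega⟩ else a k
  let b' : Fin n → Fin n := fun k => if (k : ℕ) = 2 then ⟨0, by omega⟩ else b k
  have ha : ∀ k : Fin n, 3 ≤ (k : ℕ) → a' k = a k := fun k hk => if_neg (by omega)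
  have hb : ∀ k : Fin n, 3 ≤ (k : ℕ) → b' k = b k := fun k hk => if_neg (by omega)
  have hE : mopEdges n hn a b = mopEdges n hn a' b' := by
    ext e
    simp only [mopEdges, Set.mem_ofPred_eq]
    refine or_congr_right (or_congr_right (or_congr_right (exists_congr fun k =>
      and_congr_right fun hk => ?_)))
    rw [ha k hk, hb k hk]
  refine ⟨a', b', hE ▸ isParents_fromEdgeSet hn (fun k hk => ?_) (fun k hk => ?_)
    (fun k hk => ?_) fun k hk => ?_⟩
  · rw [ha k hk, hb k hk]; exact h k hk
  · rw [ha k hk, hb k hk, ← hE]; exact h' k hk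
  · simp [a', hk]
  · simp [b', hk]

variable {G : SimpleGraph (Fin n)} {a b : Fin n → Fin n}

lemma card_edgeMS_of_isParents (hn : 3 ≤ n) (hG : IsParents G a b) :
    (edgeMS G).card = 2 * n - 3 := by
  let K : Finset (Fin n) := Finset.Ici ⟨2, by omega⟩
  have hK : ∀ k, k ∈ K ↔ 2 ≤ (k : ℕ) := fun k => by simp [K, Fin.le_def]
  have hKc : K.card = n - 2 := by simp [K]
  let A := K.image fun k => s(a k, k)
  let B := K.image fun k => s(b k, k)
  let e₀ : Sym2 (Fin n) := s(⟨0, by omega⟩, ⟨1, by omega⟩)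
  have hE : G.edgeSet.toFinite.toFinset = insert e₀ (A ∪ B) := by
    ext e
    simp only [Set.Finite.mem_toFinset, Finset.mem_insert, Finset.mem_union, A, B,
      Finset.mem_image, hK]
    constructor
    · induction e with | _ x y =>
      wlog hxy : x < y generalizing x y
      · intro h
        have hne : x ≠ y := G.ne_of_adj h
        rw [Sym2.eq_swap]
        exact this y x (lt_of_le_of_ne (not_lt.1 hxy) hne.symm) (G.adj_symm h)
      · intro h
        rcases (hG.adj_iff x y hxy).1 h with h | ⟨hy, h | h⟩
        · left
          simp [e₀, Fin.ext_iff, h]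
        · exact Or.inr (Or.inl ⟨y, hy, h ▸ rfl⟩)
        · exact Or.inr (Or.inr ⟨y, hy, h ▸ rfl⟩)
    · rintro (rfl | ⟨k, hk, rfl⟩ | ⟨k, hk, rfl⟩)
      · exact (hG.adj_iff _ _ (by simp)).2 (Or.inl ⟨rfl, rfl⟩)
      · exact (hG.adj_iff _ _ (hG.left_lt k hk)).2 (Or.inr ⟨hk, Or.inl rfl⟩)
      · exact (hG.adj_iff _ _ (hG.right_lt k hk)).2 (Or.inr ⟨hk, Or.inr rfl⟩)
  have hA : A.card = n - 2 := by
    rw [← hKc]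
    refine Finset.card_image_of_injOn fun k hk l hl h => ?_
    have := hG.left_lt k ((hK k).1 hk)
    have := hG.left_lt l ((hK l).1 hl)
    simp only [Sym2.eq_iff, Fin.ext_iff] at h ⊢
    omega
  have hB : B.card = n - 2 := by
    rw [← hKc]
    refine Finset.card_image_of_injOn fun k hk l hl h => ?_
    have := hG.right_lt k ((hK k).1 hk)
    have := hG.right_lt l ((hK l).1 hl)
    simp only [Sym2.eq_iff, Fin.ext_iff] at h ⊢
    omega
  have hAB : Disjoint A B := by
    simp only [Finset.disjoint_left, A, B, Finset.mem_image, hK]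
    rintro _ ⟨k, hk, rfl⟩ ⟨l, hl, h⟩
    have := hG.left_lt k hk
    have := hG.right_lt l hl
    rcases Sym2.eq_iff.1 h with ⟨h1, rfl⟩ | ⟨h1, h2⟩
    · exact hG.ne l hk (congrArg Fin.val h1.symm)
    · rw [Fin.ext_iff] at h1 h2
      omega
  have he₀ : e₀ ∉ A ∪ B := by
    simp only [e₀, A, B, Finset.mem_union, Finset.mem_image, hK, Sym2.eq_iff, Fin.ext_iff]
    rintro (⟨k, hk, h⟩ | ⟨k, hk, h⟩) <;> omega
  rw [edgeMS, hE, Finset.card_val, Finset.card_insert_of_notMem he₀,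
    Finset.card_union_of_disjoint hAB, hA, hB]
  omega

/-- The triangle spanned by a vertex and its parents. -/
def parentTriangle (a b : Fin n → Fin n) (k : Fin n) : Multiset (Sym2 (Fin n)) :=
  {s(k, a k), s(a k, b k), s(k, b k)}

lemma mem_parentTriangle {e : Sym2 (Fin n)} {k : Fin n} :
    e ∈ parentTriangle a b k ↔ e = s(k, a k) ∨ e = s(a k, b k) ∨ e = s(k, b k) := by
  simp [parentTriangle]

lemma isTriangle_parentTriangle (hG : IsParents G a b) {k : Fin n} (hk : 2 ≤ (k : ℕ)) :
    IsTriangle (parentTriangle a b k) :=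
  ⟨k, a k, b k, Fin.ne_of_gt (hG.left_lt k hk), (hG.adj_parents k hk).ne,
    Fin.ne_of_gt (hG.right_lt k hk), rfl⟩

lemma mem_edgeSet_of_mem_parentTriangle (hG : IsParents G a b) {k : Fin n}
    (hk : 2 ≤ (k : ℕ)) {e : Sym2 (Fin n)} (he : e ∈ parentTriangle a b k) : e ∈ G.edgeSet := by
  rcases mem_parentTriangle.1 he with rfl | rfl | rfl
  · exact ((hG.adj_iff _ _ (hG.left_lt k hk)).2 (Or.inr ⟨hk, Or.inl rfl⟩)).symm
  · exact hG.adj_parents k hk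
  · exact ((hG.adj_iff _ _ (hG.right_lt k hk)).2 (Or.inr ⟨hk, Or.inr rfl⟩)).symm

/-- Parent triangles covering all edges yield a set of duplicated edges. -/
lemma exists_duplication_of_parents (hn : 3 ≤ n) (hG : IsParents G a b) (K : Finset (Fin n))
    (hK : ∀ k ∈ K, 2 ≤ (k : ℕ)) (hK₂ : ⟨2, hn⟩ ∈ K)
    (ha : ∀ k ∉ K, 2 ≤ (k : ℕ) → ∃ l ∈ K, s(a k, k) = s(a l, b l))
    (hb : ∀ k ∉ K, 2 ≤ (k : ℕ) → ∃ l ∈ K, s(b k, k) = s(a l, b l)) :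
    ∃ D : Multiset (Sym2 (Fin n)), D.card = 3 * K.card - (2 * n - 3) ∧
      (∀ e ∈ D, e ∈ G.edgeSet) ∧ TriDecomp (edgeMS G + D) := by
  have hcov : ∀ x y : Fin n, x < y → G.Adj x y → ∃ k ∈ K, s(x, y) ∈ parentTriangle a b k := by
    intro x y hxy hadj
    rcases (hG.adj_iff x y hxy).1 hadj with h | ⟨hy, rfl | rfl⟩
    · refine ⟨⟨2, hn⟩, hK₂, mem_parentTriangle.2 (Or.inr (Or.inl ?_))⟩
      have h₁ := hG.left_lt ⟨2, hn⟩ le_rfl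
      have h₂ := hG.right_lt ⟨2, hn⟩ le_rfl
      have h₃ := hG.ne ⟨2, hn⟩ le_rfl
      simp only at h₁ h₂
      simp only [Sym2.eq_iff, Fin.ext_iff]
      omega
    · by_cases hyK : y ∈ K
      · exact ⟨y, hyK, mem_parentTriangle.2 (Or.inl Sym2.eq_swap)⟩
      · obtain ⟨l, hl, h⟩ := ha y hyK hy
        exact ⟨l, hl, mem_parentTriangle.2 (Or.inr (Or.inl h))⟩
    · by_cases hyK : y ∈ K
      · exact ⟨y, hyK, mem_parentTriangle.2 (Or.inr (Or.inr Sym2.eq_swap))⟩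
      · obtain ⟨l, hl, h⟩ := hb y hyK hy
        exact ⟨l, hl, mem_parentTriangle.2 (Or.inr (Or.inl h))⟩
  have := exists_duplication (G := G) (F := K.val.map (parentTriangle a b)) ?_ ?_ ?_
  · rwa [Multiset.card_map, Finset.card_val, card_edgeMS_of_isParents hn hG] at this
  · intro t ht
    obtain ⟨k, hk, rfl⟩ := Multiset.mem_map.1 ht
    exact isTriangle_parentTriangle hG (hK k hk)
  · intro t ht e he
    obtain ⟨k, hk, rfl⟩ := Multiset.mem_map.1 ht
    exact mem_edgeSet_of_mem_parentTriangle hG (hK k hk) he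
  · intro e he
    induction e with | _ x y =>
    rcases lt_or_gt_of_ne (G.ne_of_adj he) with h | h
    · obtain ⟨k, hk, hxy⟩ := hcov x y h he
      exact ⟨_, Multiset.mem_map_of_mem _ hk, hxy⟩
    · obtain ⟨k, hk, hxy⟩ := hcov y x h (G.adj_symm he)
      exact ⟨_, Multiset.mem_map_of_mem _ hk, Sym2.eq_swap ▸ hxy⟩

/-- If the edges joining each `k ∈ K` to its parent `q k` lie in no other parent triangle of a
vertex of `K`, then every decomposition uses at least as many triangles as `K` has elements. -/
lemma le_card_duplication_of_parents (hn : 3 ≤ n) (hG : IsParents G a b) (K : Finset (Fin n))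
    (hK : ∀ k ∈ K, 2 ≤ (k : ℕ)) (q : Fin n → Fin n) (hq : ∀ k ∈ K, q k = a k ∨ q k = b k)
    (hqK : ∀ k ∈ K, ∀ l ∈ K, s(a k, b k) ≠ s(q l, l))
    {D : Multiset (Sym2 (Fin n))} (hD : ∀ e ∈ D, e ∈ G.edgeSet)
    (hGD : TriDecomp (edgeMS G + D)) :
    3 * K.card - (2 * n - 3) ≤ D.card := by
  classical
  have hlt : ∀ k ∈ K, q k < k := fun k hk => by
    rcases hq k hk with h | h <;> rw [h]
    exacts [hG.left_lt k (hK k hk), hG.right_lt k (hK k hk)]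
  let B := K.image fun k => s(q k, k)
  have hB : ∀ x y, x < y → s(x, y) ∈ B → y ∈ K ∧ x = q y := fun x y hxy h => by
    obtain ⟨k, hk, h⟩ := Finset.mem_image.1 h
    rcases Sym2.eq_iff.1 h with ⟨rfl, rfl⟩ | ⟨rfl, rfl⟩
    · exact ⟨hk, rfl⟩
    · exact absurd hxy (hlt _ hk).asymm
  have hBc : B.card = K.card := Finset.card_image_of_injOn fun k hk l hl h => by
    have hk' := hlt k hk
    have hl' := hlt l hl
    rcases Sym2.eq_iff.1 h with h | ⟨h₁, h₂⟩
    · exact h.2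
    · rw [h₁] at hk'
      rw [← h₂] at hl'
      exact absurd hk' hl'.asymm
  have hBG : ∀ e ∈ B, e ∈ G.edgeSet := fun e he => by
    obtain ⟨k, hk, rfl⟩ := Finset.mem_image.1 he
    exact (hG.adj_iff _ _ (hlt k hk)).2 (Or.inr ⟨hK k hk, hq k hk⟩)
  have := le_card_duplication B hBG (fun t ht htG => ?_) hD hGD
  · rw [hBc, card_edgeMS_of_isParents hn hG] at this
    omega
  · obtain ⟨x, y, z, hxy, hyz, rfl⟩ := ht.exists_lt
    have hz : 2 ≤ (z : ℕ) := by rw [Fin.lt_def] at hxy hyz; omega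
    have hy := (hG.adj_iff y z hyz).1 (htG s(y, z) (by simp))
    have hx := (hG.adj_iff x z (hxy.trans hyz)).1 (htG s(x, z) (by simp))
    have hxyz : s(a z, b z) = s(x, y) := by
      rw [Fin.lt_def] at hxy
      simp only [Sym2.eq_iff, Fin.ext_iff] at hx hy ⊢
      omega
    have h₁ : s(x, y) ∈ B → z ∉ K := fun h hzK => by
      obtain ⟨hyK, h⟩ := hB x y hxy h
      exact hqK z hzK y hyK (hxyz.trans (by rw [h]))
    have h₂ := hB y z hyz
    have h₃ := hB x z (hxy.trans hyz)
    have h₄ := hxy.ne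
    simp only [Multiset.insert_eq_cons, Multiset.countP_cons, ← Multiset.cons_zero,
      Multiset.countP_zero]
    grind

lemma three_dvd_of_isMOP (hn : 3 ≤ n) (hG : IsMOP G) : 3 ∣ 2 * n - 3 + epsDelta G := by
  obtain ⟨a, b, h⟩ := hG.exists_isParents
  have hK : ∀ k, k ∈ Finset.Ici (⟨2, hn⟩ : Fin n) ↔ 2 ≤ (k : ℕ) := fun k => by
    simp [Fin.le_def]
  obtain ⟨D, hD⟩ := exists_duplication_of_parents hn h (Finset.Ici ⟨2, hn⟩)
    (fun k => (hK k).1) ((hK _).2 le_rfl) (fun k hk hk₂ => absurd ((hK k).2 hk₂) hk)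
    (fun k hk hk₂ => absurd ((hK k).2 hk₂) hk)
  obtain ⟨D', hD', -, T, hT, hTs⟩ := Nat.sInf_mem (s := {k | ∃ D : Multiset (Sym2 (Fin n)),
    D.card = k ∧ (∀ e ∈ D, e ∈ G.edgeSet) ∧ TriDecomp (edgeMS G + D)}) ⟨_, D, rfl, hD.2⟩
  have := card_sum_of_isTriangle hT
  rw [hTs, Multiset.card_add, card_edgeMS_of_isParents hn h, hD'] at this
  exact ⟨T.card, this⟩

end Parents

section Caterpillar

/-- The larger parent of `k` in the outerplanar graph whose dual tree is a caterpillar with `j`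
pairwise nonadjacent vertices of degree three, followed by a path. -/
def caterpillarLeft (j k : ℕ) : ℕ :=
  if 3 ≤ k ∧ k < 3 * j + 3 ∧ k % 3 = 2 then k - 2 else k - 1

/-- The smaller parent of `k`, see `caterpillarLeft`. -/
def caterpillarRight (j k : ℕ) : ℕ :=
  if k = 2 then 0 else if 3 * j + 3 ≤ k then 3 * j else if k % 3 = 1 then k - 4 else k - 3

lemma exists_finset_card_eq_sub {n j : ℕ} (hj : 3 * j + 3 ≤ n) :
    ∃ K : Finset (Fin n), K.card = n - (j + 2) ∧
      ∀ k, k ∈ K ↔ 2 ≤ (k : ℕ) ∧ ((k : ℕ) % 3 ≠ 0 ∨ 3 * j < k) := by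
  let g : Fin (j + 2) → Fin n := fun i =>
    ⟨if (i : ℕ) = 0 then 1 else 3 * (i - 1), by have := i.2; split_ifs <;> omega⟩
  have hg : g.Injective := fun x y h => by
    simp only [g, Fin.ext_iff] at h ⊢
    split_ifs at h <;> omega
  refine ⟨(Finset.univ.image g)ᶜ, ?_, fun k => ?_⟩
  · rw [Finset.card_compl, Finset.card_image_of_injective _ hg]
    simp
  · simp only [Finset.mem_compl, Finset.mem_image, Finset.mem_univ, true_and, not_exists]
    constructor
    · intro h
      by_contra hc
      by_cases hk : (k : ℕ) = 1
      · exact h ⟨0, by omega⟩ (Fin.ext (by simp [g, hk]))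
      · exact h ⟨(k : ℕ) / 3 + 1, by omega⟩ (Fin.ext (by simp [g]; omega))
    · rintro h i rfl
      have := i.2
      simp only [g] at h
      split_ifs at h <;> omega

lemma exists_isMOP_epsDelta_eq_sub (n j : ℕ) (hj : 3 * j + 3 ≤ n) :
    ∃ G : SimpleGraph (Fin n), IsMOP G ∧ epsDelta G = n - 3 - 3 * j := by
  have hn : 3 ≤ n := by omega
  let a : Fin n → Fin n := fun k =>
    ⟨caterpillarLeft j k, by have := k.2; unfold caterpillarLeft; split_ifs <;> omega⟩
  let b : Fin n → Fin n := fun k =>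
    ⟨caterpillarRight j k, by have := k.2; unfold caterpillarRight; split_ifs <;> omega⟩
  have ha : ∀ k, (a k : ℕ) = caterpillarLeft j k := fun k => rfl
  have hb : ∀ k, (b k : ℕ) = caterpillarRight j k := fun k => rfl
  have hlt : ∀ k : Fin n, 2 ≤ (k : ℕ) → (b k : ℕ) < a k ∧ (a k : ℕ) < k := fun k hk => by
    rw [ha, hb, caterpillarLeft, caterpillarRight]
    split_ifs <;> omega
  have h₁ : ∀ k : Fin n, 3 ≤ (k : ℕ) → (a k : ℕ) < k ∧ (b k : ℕ) < k ∧ a k ≠ b k :=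
    fun k hk => by
      have := hlt k (by omega)
      rw [Ne, Fin.ext_iff]
      omega
  have h₂ : ∀ k : Fin n, 3 ≤ (k : ℕ) → s(a k, b k) ∈ mopEdges n hn a b := fun k hk => by
    rw [Sym2.eq_swap, mem_mopEdges_iff_of_lt hn h₁ (hlt k (by omega)).1]
    simp only [Fin.ext_iff, ha, hb, caterpillarLeft, caterpillarRight]
    grind
  have h₃ : ∀ k l : Fin n, 3 ≤ (k : ℕ) → 3 ≤ (l : ℕ) → k ≠ l → s(a k, b k) ≠ s(a l, b l) :=
    fun k l hk hl hkl h => by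
      have := hlt k (by omega)
      have := hlt l (by omega)
      apply hkl
      simp only [Sym2.eq_iff, Fin.ext_iff] at h ⊢
      replace h : (a k : ℕ) = a l ∧ (b k : ℕ) = b l := by omega
      simp only [ha, hb, caterpillarLeft, caterpillarRight] at h
      grind
  have hG := isParents_fromEdgeSet hn h₁ h₂ (fun k hk => by simp [ha, hk, caterpillarLeft])
    (fun k hk => by simp [hb, hk, caterpillarRight])
  refine ⟨_, ⟨hn, a, b, h₁, h₂, h₃, rfl⟩, ?_⟩
  obtain ⟨K, hKc, hK⟩ := exists_finset_card_eq_sub hj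
  obtain ⟨D, hD⟩ := exists_duplication_of_parents hn hG K (fun k hk => ((hK k).1 hk).1)
    ((hK _).2 (by simp))
    (fun k hk hk₂ => by
      rw [hK] at hk
      refine ⟨⟨k + 2, by omega⟩, (hK _).2 (by simp only; omega), ?_⟩
      rw [Sym2.eq_swap]
      simp only [Sym2.eq_iff, Fin.ext_iff, ha, hb, caterpillarLeft, caterpillarRight]
      grind)
    (fun k hk hk₂ => by
      rw [hK] at hk
      refine ⟨⟨k + 1, by omega⟩, (hK _).2 (by simp only; omega), ?_⟩
      rw [Sym2.eq_swap]
      simp only [Sym2.eq_iff, Fin.ext_iff, ha, hb, caterpillarLeft, caterpillarRight]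
      grind)
  have hcard : n - 3 - 3 * j = 3 * K.card - (2 * n - 3) := by omega
  rw [hcard, epsDelta]
  apply le_antisymm
  · exact Nat.sInf_le ⟨D, hD⟩
  · have hne : {k | ∃ D : Multiset (Sym2 (Fin n)), D.card = k ∧
        (∀ e ∈ D, e ∈ (SimpleGraph.fromEdgeSet (mopEdges n hn a b)).edgeSet) ∧
        TriDecomp (edgeMS (SimpleGraph.fromEdgeSet (mopEdges n hn a b)) + D)}.Nonempty :=
      ⟨_, D, rfl, hD.2⟩
    obtain ⟨D', hD'c, hD'⟩ := Nat.sInf_mem hne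
    rw [← hD'c]
    let p : Fin n → Prop := fun k => 3 ≤ (k : ℕ) ∧ (k : ℕ) < 3 * j + 3 ∧ (k : ℕ) % 3 = 2
    refine le_card_duplication_of_parents hn hG K (fun k hk => ((hK k).1 hk).1)
      (fun k => if p k then b k else a k) (fun k hk => by grind) (fun k hk l hl h => ?_)
      hD'.1 hD'.2
    have hk' := (hK k).1 hk
    have hl' := (hK l).1 hl
    have := hlt k hk'.1
    have := hlt l hl'.1
    simp only [p, Sym2.eq_iff, Fin.ext_iff, apply_ite Fin.val] at h
    replace h : (a k : ℕ) = l ∧ (b k : ℕ) = if p l then (b l : ℕ) else a l := by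
      grind
    simp only [p, ha, hb, caterpillarLeft, caterpillarRight] at h
    obtain ⟨h, h'⟩ := h
    split_ifs at h h' <;> omega

end Caterpillar

/-- For every `n ≥ 3` and every `r ≥ 0` with `ε_Δ(OP_n) + 3r ≤ n - 3`, there is a maximal
outerplanar graph `G_r` of order `n` with `ε_Δ(G_r) = ε_Δ(OP_n) + 3r`. -/
theorem exists_isMOP_epsDelta_eq (n : ℕ) (hn : 3 ≤ n) (r : ℕ)
    (hr : epsOP n + 3 * r ≤ n - 3) :
    ∃ G : SimpleGraph (Fin n), IsMOP G ∧ epsDelta G = epsOP n + 3 * r := by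
  obtain ⟨G₀, hG₀, -⟩ := exists_isMOP_epsDelta_eq_sub n 0 (by omega)
  obtain ⟨G₁, hG₁, h₁⟩ := Nat.sInf_mem
    (s := {m | ∃ G : SimpleGraph (Fin n), IsMOP G ∧ epsDelta G = m}) ⟨_, G₀, hG₀, rfl⟩
  have hdvd := three_dvd_of_isMOP hn hG₁
  rw [h₁] at hdvd
  change 3 ∣ 2 * n - 3 + epsOP n at hdvd
  obtain ⟨G, hG, h⟩ := exists_isMOP_epsDelta_eq_sub n ((n - 3 - (epsOP n + 3 * r)) / 3)
    (by omega)
  exact ⟨G, hG, by omega⟩
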